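/- Let (X, μ) be a measurable space with a finite measure μ, let u : X → ℝ be measurable with u(x) ≤ 0 for all x ∈ X, and let χ : ℝ → ℝ be a nonnegative, antitone, continuously differentiable function satisfying χ(2t) ≤ M·χ(t) for all t ≤ 0, where M ≥ 1. Then for every real λ ≥ 1, ∫₀^∞ (−χ′(−t))·μ({x : u(x) < −t/λ}) dt ≤ M·λ^(log₂ M)·∫ χ(u(x)) dμ(x), as an inequality in the extended nonnegative reals [0, ∞]. -/

import Mathlib

open MeasureTheory Set

/-- Iterating the doubling condition `n` times. -/
theorem doubling_iterate {χ : ℝ → ℝ} {M : ℝ} (hM : 0 ≤ M)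
    (hdouble : ∀ t ≤ (0 : ℝ), χ (2 * t) ≤ M * χ t) (n : ℕ) {t : ℝ} (ht : t ≤ 0) :
    χ (2 ^ n * t) ≤ M ^ n * χ t := by
  induction n with
  | zero => simp
  | succ n ih =>
    calc χ (2 ^ (n + 1) * t) = χ (2 * (2 ^ n * t)) := by ring_nf
      _ ≤ M * χ (2 ^ n * t) := hdouble _ (mul_nonpos_of_nonneg_of_nonpos (by positivity) ht)
      _ ≤ M * (M ^ n * χ t) := by gcongr
      _ = M ^ (n + 1) * χ t := by ring

/-- The doubling condition forces growth of order at most `logb 2 M`. -/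
theorem doubling_growth {χ : ℝ → ℝ} (hχ0 : ∀ t, 0 ≤ χ t) (hχa : Antitone χ)
    {M : ℝ} (hM : 1 ≤ M) (hdouble : ∀ t ≤ (0 : ℝ), χ (2 * t) ≤ M * χ t)
    {l : ℝ} (hl : 1 ≤ l) {t : ℝ} (ht : t ≤ 0) :
    χ (l * t) ≤ M * l ^ Real.logb 2 M * χ t := by
  have hl0 : 0 < l := by linarith
  have hM0 : 0 < M := by linarith
  set n := ⌈Real.logb 2 l⌉₊
  have hln : l ≤ 2 ^ n := by
    rw [← Real.rpow_natCast, ← Real.logb_le_iff_le_rpow one_lt_two hl0]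
    exact Nat.le_ceil _
  have hn : (n : ℝ) ≤ 1 + Real.logb 2 l := by
    linarith [Nat.ceil_lt_add_one (Real.logb_nonneg one_lt_two hl)]
  have hswap : M ^ Real.logb 2 l = l ^ Real.logb 2 M := by
    rw [Real.rpow_def_of_pos hM0, Real.rpow_def_of_pos hl0, Real.logb, Real.logb]
    ring_nf
  have hMn : M ^ n ≤ M * l ^ Real.logb 2 M := by
    rw [← hswap, ← Real.rpow_natCast, ← Real.rpow_one_add' hM0.le
      (by linarith [Real.logb_nonneg one_lt_two hl])]
    exact Real.rpow_le_rpow_of_exponent_le hM hn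
  calc χ (l * t) ≤ χ (2 ^ n * t) := hχa (mul_le_mul_of_nonpos_right hln ht)
    _ ≤ M ^ n * χ t := doubling_iterate hM0.le hdouble n ht
    _ ≤ M * l ^ Real.logb 2 M * χ t := mul_le_mul_of_nonneg_right hMn (hχ0 t)

/-- Layer-cake estimate with doubling weight: for `χ ∈ 𝒜_M` and `λ ≥ 1`,
`∫₀^∞ (−χ′(−t))·μ({u < −t/λ}) dt ≤ M·λ^(log₂ M)·∫ χ(u) dμ` in `[0,∞]`. -/
theorem layer_cake_doubling_estimate {X : Type*} [MeasurableSpace X] (μ : Measure X)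
    [IsFiniteMeasure μ]
    (u : X → ℝ) (hu : Measurable u) (hu0 : ∀ x, u x ≤ 0)
    (χ : ℝ → ℝ) (hχ0 : ∀ t, 0 ≤ χ t) (hχa : Antitone χ) (hχd : ContDiff ℝ 1 χ)
    (M : ℝ) (hM : 1 ≤ M) (hdouble : ∀ t ≤ (0 : ℝ), χ (2 * t) ≤ M * χ t)
    (l : ℝ) (hl : 1 ≤ l) :
    ∫⁻ t in Ioi (0 : ℝ), ENNReal.ofReal (-(deriv χ (-t))) * μ {x | u x < -t / l}
      ≤ ENNReal.ofReal (M * l ^ Real.logb 2 M) * ∫⁻ x, ENNReal.ofReal (χ (u x)) ∂μ := by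
  have hl0 : 0 < l := by linarith
  have hcont : Continuous fun t => -(deriv χ (-t)) :=
    ((hχd.continuous_deriv le_rfl).comp continuous_neg).neg
  have hset (t : ℝ) : {x | u x < -t / l} = {x | t < -(l * u x)} := by
    ext x
    simp only [mem_ofPred_eq, lt_div_iff₀ hl0]
    constructor <;> intro h <;> linarith
  have hprim (s : ℝ) : ∫ t in (0 : ℝ)..s, -(deriv χ (-t)) = χ (-s) - χ 0 := by
    have hderiv (t : ℝ) : HasDerivAt (fun t => χ (-t)) (-(deriv χ (-t))) t := by
      simpa [Function.comp_def] using
        ((hχd.differentiable one_ne_zero) (-t)).hasDerivAt.comp t (hasDerivAt_neg t)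
    simpa using intervalIntegral.integral_eq_sub_of_hasDerivAt (fun t _ => hderiv t)
      (hcont.intervalIntegrable 0 s)
  have hcake := lintegral_comp_eq_lintegral_meas_lt_mul μ (f := fun x => -(l * u x))
    (g := fun t => -(deriv χ (-t)))
    (.of_forall fun x => neg_nonneg.2 (mul_nonpos_of_nonneg_of_nonpos hl0.le (hu0 x)))
    (hu.const_mul l).neg.aemeasurable (fun t _ => hcont.intervalIntegrable 0 t)
    (.of_forall fun t => neg_nonneg.2 hχa.deriv_nonpos)
  simp_rw [hset, mul_comm (ENNReal.ofReal _) (μ _)]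
  rw [← hcake, ← lintegral_const_mul' _ _ ENNReal.ofReal_ne_top]
  refine lintegral_mono fun x => ?_
  rw [hprim, neg_neg, ← ENNReal.ofReal_mul (by positivity)]
  refine ENNReal.ofReal_le_ofReal ?_
  linarith [hχ0 0, doubling_growth hχ0 hχa hM hdouble hl (hu0 x)]
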